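/- Let n ≥ 3 and for each i ∈ {0, 1, …, n−1} define the ray trajectory γᵢ : ℝ → ℝ² by γᵢ(t) = t · (cos(2πi/n), sin(2πi/n)). Then for every unit vector u ∈ ℝ² and every ρ > 0, there exist an index i and a time t with 0 ≤ t ≤ ρ / cos(π/n) such that ⟪u, γᵢ(t)⟫ = ρ. That is, every line at distance ρ > 0 from the origin is hit by some robot within time ρ / cos(π/n), so this ray algorithm witnesses that the best possible search competitive ratio 𝒮ₙ is at most 1/cos(π/n) for all n ≥ 3. -/

import Mathlib

open Real
open scoped RealInnerProductSpace

/-- The ray trajectory of robot `i` among `n`: unit-speed motion along the ray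
from the origin in direction `(cos(2πi/n), sin(2πi/n))`. -/
noncomputable def rayTraj (n : ℕ) (i : Fin n) (t : ℝ) : EuclideanSpace ℝ (Fin 2) :=
  t • (WithLp.equiv 2 (Fin 2 → ℝ)).symm
    ![Real.cos (2 * π * i / n), Real.sin (2 * π * i / n)]

/-- Every angle is within `π / n` of one of the angles `2πi/n`, modulo `2π`. -/
theorem exists_fin_cos_pi_div_le_cos_sub (n : ℕ) (hn : 0 < n) (θ : ℝ) :
    ∃ i : Fin n, Real.cos (π / n) ≤ Real.cos (θ - 2 * π * i / n) := by
  have hn' : (0 : ℝ) < n := by exact_mod_cast hn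
  have hnz : (0 : ℤ) < n := by exact_mod_cast hn
  set k : ℤ := round (θ * n / (2 * π))
  have hmod : 0 ≤ k % n := Int.emod_nonneg _ hnz.ne'
  have hlt : k % n < n := Int.emod_lt_of_pos _ hnz
  refine ⟨⟨(k % n).toNat, by omega⟩, ?_⟩
  have hcast : (((k % n).toNat : ℕ) : ℝ) = k - n * (k / n : ℤ) := by
    have h : (((k % n).toNat : ℕ) : ℤ) = k - n * (k / n) := by
      rw [Int.toNat_of_nonneg hmod, Int.emod_def]
    exact_mod_cast h
  have hangle : θ - 2 * π * (((k % n).toNat : ℕ) : ℝ) / n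
      = (θ - 2 * π * k / n) + (k / n : ℤ) * (2 * π) := by
    rw [hcast]
    field_simp
    ring
  have habs : |θ - 2 * π * k / n| ≤ π / n := by
    have hround := abs_sub_round (θ * n / (2 * π))
    have hfactor : θ - 2 * π * k / n = 2 * π / n * (θ * n / (2 * π) - k) := by
      field_simp
    rw [hfactor, abs_mul, abs_of_pos (by positivity)]
    calc 2 * π / n * |θ * n / (2 * π) - k| ≤ 2 * π / n * (1 / 2) := by gcongr
      _ = π / n := by ring
  rw [hangle, Real.cos_add_int_mul_two_pi, ← Real.cos_abs (θ - 2 * π * k / n)]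
  exact Real.cos_le_cos_of_nonneg_of_le_pi (abs_nonneg _)
    (div_le_self pi_pos.le (by exact_mod_cast hn)) habs

/-- A unit vector of the Euclidean plane has a polar angle. -/
theorem exists_angle_of_norm_eq_one (u : EuclideanSpace ℝ (Fin 2)) (hu : ‖u‖ = 1) :
    ∃ θ : ℝ, u 0 = Real.cos θ ∧ u 1 = Real.sin θ := by
  have hsq : u 0 ^ 2 + u 1 ^ 2 = 1 := by
    have h := EuclideanSpace.real_norm_sq_eq u
    rw [hu, Fin.sum_univ_two] at h
    linarith
  have hz : ‖(⟨u 0, u 1⟩ : ℂ)‖ = 1 := by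
    rw [Complex.norm_eq_sqrt_sq_add_sq, hsq, Real.sqrt_one]
  refine ⟨Complex.arg ⟨u 0, u 1⟩, ?_, ?_⟩
  · rw [← one_mul (Real.cos _), ← hz, Complex.norm_mul_cos_arg]
  · rw [← one_mul (Real.sin _), ← hz, Complex.norm_mul_sin_arg]

theorem inner_rayTraj (n : ℕ) (i : Fin n) (t θ : ℝ) (u : EuclideanSpace ℝ (Fin 2))
    (h0 : u 0 = Real.cos θ) (h1 : u 1 = Real.sin θ) :
    ⟪u, rayTraj n i t⟫ = t * Real.cos (θ - 2 * π * i / n) := by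
  simp [rayTraj, PiLp.inner_apply, Fin.sum_univ_two, h0, h1, Real.cos_sub]
  ring

theorem ray_algorithm_upper_bound
    (n : ℕ) (hn : 3 ≤ n)
    (u : EuclideanSpace ℝ (Fin 2)) (hu : ‖u‖ = 1)
    (ρ : ℝ) (hρ : 0 < ρ) :
    ∃ i : Fin n, ∃ t : ℝ, 0 ≤ t ∧ t ≤ ρ / Real.cos (π / n) ∧
      ⟪u, rayTraj n i t⟫ = ρ := by
  obtain ⟨θ, h0, h1⟩ := exists_angle_of_norm_eq_one u hu
  obtain ⟨i, hi⟩ := exists_fin_cos_pi_div_le_cos_sub n (by omega) θ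
  have hn' : (3 : ℝ) ≤ n := by exact_mod_cast hn
  have hcos : 0 < Real.cos (π / n) := by
    apply Real.cos_pos_of_mem_Ioo
    have hdiv : π / n < π / 2 := div_lt_div_of_pos_left pi_pos two_pos (by linarith)
    have hpos : 0 < π / n := div_pos pi_pos (by linarith)
    exact ⟨by linarith [pi_pos], hdiv⟩
  have hcos' := hcos.trans_le hi
  refine ⟨i, ρ / Real.cos (θ - 2 * π * i / n), by positivity, by gcongr, ?_⟩
  rw [inner_rayTraj n i _ θ u h0 h1, div_mul_cancel₀ _ hcos'.ne']
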